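/- For a fixed increasing minimum power profile, the optimal total power profile of the broadcast channel inner problem is increasing: let p₂ ∈ [0,∞)^N be nondecreasing (p_{21} ≤ p_{22} ≤ ⋯ ≤ p_{2N}) and satisfy ∑_{i=1}^k p_{2i} ≤ min(∑_{i=1}^k Ē_{1i}, (1/σ²)·∑_{i=1}^k E_i) for all k, and define B_k(p₂) := min{ ∑_{i=1}^k Ē_{1i}, ∑_{i=1}^k (E_i − (σ²−1)·p_{2i}) }. Then the feasible set { p_t ∈ ℝ^N : p_{ti} ≥ p_{2i} for all i, ∑_{i=1}^k p_{ti} ≤ B_k(p₂) for all k } is nonempty, and every p_t in this set maximizing ∑_{i=1}^N g(p_{ti}) is nondecreasing: p_{t1} ≤ p_{t2} ≤ ⋯ ≤ p_{tN}. -/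

import Mathlib

open Finset

/-- The rate function `g(p) = (1/2)·log₂(1+p)`. -/
noncomputable def gfun (p : ℝ) : ℝ := Real.logb 2 (1 + p) / 2

/-- for a fixed nondecreasing minimum power profile `p2`, the BC inner
problem is feasible and every optimal total power profile `pt` is nondecreasing. -/
theorem bc_inner_optimal_total_power_monotone
    (N : ℕ) (hN : 1 ≤ N)
    (σ2 : ℝ) (hσ2 : 1 < σ2)
    (E Eb1 Eb2 : ℕ → ℝ)
    (hE : ∀ i ∈ Finset.Icc 1 N, 0 ≤ E i)
    (hEb1 : ∀ i ∈ Finset.Icc 1 N, 0 ≤ Eb1 i)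
    (hEb2 : ∀ i ∈ Finset.Icc 1 N, 0 ≤ Eb2 i)
    (p2 : ℕ → ℝ)
    (hp2_nonneg : ∀ i ∈ Finset.Icc 1 N, 0 ≤ p2 i)
    (hp2_mono : ∀ i j : ℕ, 1 ≤ i → i ≤ j → j ≤ N → p2 i ≤ p2 j)
    (hp2_feas : ∀ k ∈ Finset.Icc 1 N,
        ∑ i ∈ Finset.Icc 1 k, p2 i ≤
          min (∑ i ∈ Finset.Icc 1 k, Eb1 i) ((1 / σ2) * ∑ i ∈ Finset.Icc 1 k, E i)) :
    (∃ pt : ℕ → ℝ,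
        (∀ i ∈ Finset.Icc 1 N, p2 i ≤ pt i) ∧
        (∀ k ∈ Finset.Icc 1 N,
            ∑ i ∈ Finset.Icc 1 k, pt i ≤
              min (∑ i ∈ Finset.Icc 1 k, Eb1 i)
                (∑ i ∈ Finset.Icc 1 k, (E i - (σ2 - 1) * p2 i)))) ∧
    (∀ pt : ℕ → ℝ,
        (∀ i ∈ Finset.Icc 1 N, p2 i ≤ pt i) →
        (∀ k ∈ Finset.Icc 1 N,
            ∑ i ∈ Finset.Icc 1 k, pt i ≤
              min (∑ i ∈ Finset.Icc 1 k, Eb1 i)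
                (∑ i ∈ Finset.Icc 1 k, (E i - (σ2 - 1) * p2 i))) →
        (∀ pt' : ℕ → ℝ,
            (∀ i ∈ Finset.Icc 1 N, p2 i ≤ pt' i) →
            (∀ k ∈ Finset.Icc 1 N,
                ∑ i ∈ Finset.Icc 1 k, pt' i ≤
                  min (∑ i ∈ Finset.Icc 1 k, Eb1 i)
                    (∑ i ∈ Finset.Icc 1 k, (E i - (σ2 - 1) * p2 i))) →
            ∑ i ∈ Finset.Icc 1 N, gfun (pt' i) ≤ ∑ i ∈ Finset.Icc 1 N, gfun (pt i)) →
        ∀ i j : ℕ, 1 ≤ i → i ≤ j → j ≤ N → pt i ≤ pt j) := by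
  have hσ0 : 0 < σ2 := by linarith
  refine ⟨⟨p2, fun _ _ => le_rfl, fun k hk => ?_⟩, ?_⟩
  · have h := hp2_feas k hk
    refine le_min (h.trans (min_le_left _ _)) ?_
    have h2 := h.trans (min_le_right _ _)
    rw [one_div, inv_mul_eq_div, le_div_iff₀ hσ0] at h2
    rw [Finset.sum_sub_distrib, ← Finset.mul_sum]
    linarith
  · intro pt hlow hsum hopt i j hi hij hj
    by_contra hlt
    push Not at hlt
    have hne : i ≠ j := by
      rintro rfl
      exact lt_irrefl _ hlt
    have hiN : i ∈ Finset.Icc 1 N := Finset.mem_Icc.2 ⟨hi, hij.trans hj⟩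
    have hjN : j ∈ Finset.Icc 1 N := Finset.mem_Icc.2 ⟨hi.trans hij, hj⟩
    have hp := hp2_mono i j hi hij hj
    have hlj := hlow j hjN
    have hnj := hp2_nonneg j hjN
    obtain ⟨m, hm⟩ : ∃ m, m = (pt i + pt j) / 2 := ⟨_, rfl⟩
    have key := hopt (fun x => if x = i then m else if x = j then m else pt x) ?_ ?_
    · have e : ∀ x ∈ Finset.Icc 1 N,
          gfun (if x = i then m else if x = j then m else pt x) =
            gfun (pt x) + (if x = i then gfun m - gfun (pt i) else 0)
              + (if x = j then gfun m - gfun (pt j) else 0) := by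
        intro x _
        by_cases h1 : x = i
        · subst h1
          simp [hne]
        · by_cases h2 : x = j
          · subst h2
            simp [h1]
          · simp [h1, h2]
      rw [Finset.sum_congr rfl e, Finset.sum_add_distrib, Finset.sum_add_distrib,
        Finset.sum_ite_eq', Finset.sum_ite_eq', if_pos hiN, if_pos hjN] at key
      have hlog : Real.logb 2 ((1 + pt i) * (1 + pt j)) < Real.logb 2 ((1 + m) * (1 + m)) := by
        apply Real.logb_lt_logb (by norm_num)
        · apply mul_pos <;> linarith
        · subst hm
          nlinarith [mul_pos (sub_pos.2 hlt) (sub_pos.2 hlt)]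
      rw [Real.logb_mul (by linarith) (by linarith),
        Real.logb_mul (by linarith) (by linarith)] at hlog
      unfold gfun at key
      linarith
    · intro x hx
      split_ifs with h1 h2
      · subst h1
        linarith
      · subst h2
        linarith
      · exact hlow x hx
    · intro k hk
      refine le_trans ?_ (hsum k hk)
      have e : ∀ x ∈ Finset.Icc 1 k,
          (if x = i then m else if x = j then m else pt x) =
            pt x + (if x = i then m - pt i else 0) + (if x = j then m - pt j else 0) := by
        intro x _
        by_cases h1 : x = i
        · subst h1
          simp [hne]
        · by_cases h2 : x = j
          · subst h2
            simp [h1]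
          · simp [h1, h2]
      rw [Finset.sum_congr rfl e, Finset.sum_add_distrib, Finset.sum_add_distrib,
        Finset.sum_ite_eq', Finset.sum_ite_eq']
      simp only [Finset.mem_Icc]
      split_ifs with h1 h2 h2
      · linarith
      · linarith
      · exact absurd ⟨hi, hij.trans h2.2⟩ h1
      · linarith
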